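/- (Proposition 3, part (i): convergence of relaxed FISTA to stationary points.) Under the relaxed FISTA setup with step size 0 < γ ≤ (1 − α²)/(2L) for any fixed α ∈ [0, 1), and assuming F* := inf_{x∈ℝ^N} F(x) > −∞, the gradient-mapping norms at the iterates converge to zero: lim_{k→∞} ‖G_γ(f_k)‖ = 0, where G_γ(x) = (x − prox_{γR}(x − γ∇D(x)))/γ. -/

import Mathlib

open scoped RealInnerProductSpace

/-- The gradient mapping `G_γ(x) = (x - prox_{γR}(x - γ∇D(x)))/γ`. -/
noncomputable def gradMap {N : ℕ} (γ : ℝ)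
    (gradD : EuclideanSpace ℝ (Fin N) → EuclideanSpace ℝ (Fin N))
    (prox : EuclideanSpace ℝ (Fin N) → EuclideanSpace ℝ (Fin N))
    (x : EuclideanSpace ℝ (Fin N)) : EuclideanSpace ℝ (Fin N) :=
  γ⁻¹ • (x - prox (x - γ • gradD x))

/-- The descent lemma: a function with `L`-Lipschitz gradient lies below its quadratic majorants. -/
theorem le_add_inner_add_of_lipschitz_gradient {E : Type*} [NormedAddCommGroup E]
    [InnerProductSpace ℝ E] [CompleteSpace E] {D : E → ℝ} {gradD : E → E}
    (hdiff : ∀ x, HasGradientAt D (gradD x) x) {L : ℝ}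
    (hLip : ∀ x y, ‖gradD x - gradD y‖ ≤ L * ‖x - y‖) (x y : E) :
    D y ≤ D x + ⟪gradD x, y - x⟫ + L / 2 * ‖y - x‖ ^ 2 := by
  set v := y - x with hv
  have hder : ∀ τ : ℝ, HasDerivAt
      (fun τ : ℝ => D (x + τ • v) - τ * ⟪gradD x, v⟫ - L / 2 * ‖v‖ ^ 2 * τ ^ 2)
      (⟪gradD (x + τ • v), v⟫ - ⟪gradD x, v⟫ - L * ‖v‖ ^ 2 * τ) τ := by
    intro τ
    have hline : HasDerivAt (fun τ : ℝ => x + τ • v) v τ := by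
      simpa using ((hasDerivAt_id τ).smul_const v).const_add x
    have hD := (hdiff (x + τ • v)).hasFDerivAt.comp_hasDerivAt τ hline
    have hlin := (hasDerivAt_id τ).mul_const ⟪gradD x, v⟫
    have hsq := (hasDerivAt_pow 2 τ).const_mul (L / 2 * ‖v‖ ^ 2)
    refine ((hD.sub hlin).sub hsq).congr_deriv ?_
    simp
    ring
  have hanti := antitoneOn_of_deriv_nonpos (convex_Icc (0 : ℝ) 1)
    (fun τ _ => (hder τ).continuousAt.continuousWithinAt)
    (fun τ _ => (hder τ).differentiableAt.differentiableWithinAt)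
    (fun τ hτ => by
      rw [interior_Icc] at hτ
      rw [(hder τ).deriv, ← inner_sub_left]
      have h := real_inner_le_norm (gradD (x + τ • v) - gradD x) v
      have h' := hLip (x + τ • v) x
      rw [add_sub_cancel_left, norm_smul, Real.norm_of_nonneg hτ.1.le] at h'
      nlinarith [mul_le_mul_of_nonneg_right h' (norm_nonneg v)])
  have h01 := hanti (Set.left_mem_Icc.2 zero_le_one) (Set.right_mem_Icc.2 zero_le_one) zero_le_one
  have hxy : x + v = y := by simp [hv]
  simp only [one_smul, hxy, zero_smul, add_zero] at h01
  linarith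

/-- A function with `L`-Lipschitz gradient lies above its quadratic minorants. -/
theorem add_inner_sub_le_of_lipschitz_gradient {E : Type*} [NormedAddCommGroup E]
    [InnerProductSpace ℝ E] [CompleteSpace E] {D : E → ℝ} {gradD : E → E}
    (hdiff : ∀ x, HasGradientAt D (gradD x) x) {L : ℝ}
    (hLip : ∀ x y, ‖gradD x - gradD y‖ ≤ L * ‖x - y‖) (x y : E) :
    D x + ⟪gradD x, y - x⟫ - L / 2 * ‖y - x‖ ^ 2 ≤ D y := by
  have h := le_add_inner_add_of_lipschitz_gradient (D := fun x => -D x)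
    (gradD := fun x => -gradD x) (L := L)
    (fun x => by
      rw [hasGradientAt_iff_hasFDerivAt, map_neg]
      exact (hdiff x).hasFDerivAt.neg)
    (fun x y => by rw [← norm_neg]; simpa [neg_add_eq_sub, sub_eq_add_neg, add_comm] using hLip x y)
    x y
  rw [inner_neg_left] at h
  linarith

/-- A proximal point has finite value for a proper function. -/
theorem ne_top_of_prox_minimizer {E : Type*} [NormedAddCommGroup E] {R : E → EReal} {c : ℝ}
    (hRproper : ∃ x, R x ≠ ⊤) {y p : E}
    (hp : ∀ z, R p + ((c * ‖p - y‖ ^ 2 : ℝ) : EReal) ≤ R z + ((c * ‖z - y‖ ^ 2 : ℝ) : EReal)) :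
    R p ≠ ⊤ := by
  obtain ⟨z, hz⟩ := hRproper
  intro h
  have h1 := hp z
  rw [h, EReal.top_add_coe, top_le_iff] at h1
  exact EReal.add_ne_top hz (EReal.coe_ne_top _) h1

/-- The variational inequality characterizing proximal points of a convex function. -/
theorem prox_variational_inequality {E : Type*} [NormedAddCommGroup E] [InnerProductSpace ℝ E]
    {R : E → EReal} (hRbot : ∀ x, R x ≠ ⊥)
    (hRconvex : ∀ x y : E, ∀ a b : ℝ, 0 ≤ a → 0 ≤ b → a + b = 1 →
      R (a • x + b • y) ≤ (a : EReal) * R x + (b : EReal) * R y)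
    {γ : ℝ} (hγ : 0 < γ) {y p z : E}
    (hp : ∀ z, R p + ((1 / (2 * γ) * ‖p - y‖ ^ 2 : ℝ) : EReal) ≤
      R z + ((1 / (2 * γ) * ‖z - y‖ ^ 2 : ℝ) : EReal))
    (hptop : R p ≠ ⊤) (hztop : R z ≠ ⊤) :
    γ * (R p).toReal ≤ γ * (R z).toReal + ⟪y - p, p - z⟫ := by
  have hpR := EReal.coe_toReal hptop (hRbot p)
  have hzR := EReal.coe_toReal hztop (hRbot z)
  set r := (R p).toReal
  set q := (R z).toReal
  have key : ∀ θ : ℝ, 0 < θ → θ ≤ 1 →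
      γ * r ≤ γ * q + ⟪y - p, p - z⟫ + θ * (‖z - p‖ ^ 2 / 2) := by
    intro θ h0 h1
    have hc := hRconvex p z (1 - θ) θ (by linarith) h0.le (by ring)
    have hm := (hp ((1 - θ) • p + θ • z)).trans (add_le_add_left hc _)
    rw [← hpR, ← hzR] at hm
    norm_cast at hm
    have hexp : ‖(1 - θ) • p + θ • z - y‖ ^ 2
        = ‖p - y‖ ^ 2 + 2 * θ * ⟪y - p, p - z⟫ + θ ^ 2 * ‖z - p‖ ^ 2 := by
      have h2 : (1 - θ) • p + θ • z - y = (p - y) + θ • (z - p) := by module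
      rw [h2, norm_add_sq_real, real_inner_smul_right, norm_smul, mul_pow, Real.norm_eq_abs, sq_abs,
        ← neg_sub y p, ← neg_sub p z, inner_neg_neg]
      ring
    rw [hexp] at hm
    have h3 : θ * (γ * r) ≤ θ * (γ * q + ⟪y - p, p - z⟫ + θ * (‖z - p‖ ^ 2 / 2)) := by
      have h4 := mul_le_mul_of_nonneg_left hm hγ.le
      have h5 : γ * (1 / (2 * γ)) = 1 / 2 := by field_simp
      linear_combination h4 + (2 * θ * ⟪y - p, p - z⟫ + θ ^ 2 * ‖z - p‖ ^ 2) * h5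
    exact le_of_mul_le_mul_left h3 h0
  have hlim : Filter.Tendsto (fun θ : ℝ => γ * q + ⟪y - p, p - z⟫ + θ * (‖z - p‖ ^ 2 / 2))
      (nhdsWithin 0 (Set.Ioi 0)) (nhds (γ * q + ⟪y - p, p - z⟫)) := by
    have hcont : Continuous
        (fun θ : ℝ => γ * q + ⟪y - p, p - z⟫ + θ * (‖z - p‖ ^ 2 / 2)) := by fun_prop
    simpa using (hcont.tendsto 0).mono_left nhdsWithin_le_nhds
  refine ge_of_tendsto hlim ?_
  filter_upwards [Ioc_mem_nhdsGT (zero_lt_one' ℝ)] with θ hθ using key θ hθ.1 hθ.2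

/-- The extrapolation weights of FISTA lie in `[0, 1]`. -/
theorem fista_weight_mem_Icc {t : ℕ → ℝ} (ht0 : t 0 = 1)
    (htrec : ∀ k, t (k + 1) = (Real.sqrt (4 * t k ^ 2 + 1) + 1) / 2) (k : ℕ) :
    (t k - 1) / t (k + 1) ∈ Set.Icc (0 : ℝ) 1 := by
  have hstep : ∀ k, 1 ≤ t k → t k ≤ t (k + 1) := by
    intro k hk
    have h : 2 * t k ≤ Real.sqrt (4 * t k ^ 2 + 1) :=
      Real.le_sqrt_of_sq_le (by linarith [mul_pow 2 (t k) 2])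
    rw [htrec]
    linarith
  have hone : ∀ k, 1 ≤ t k := by
    intro k
    induction k with
    | zero => exact ht0.ge
    | succ k ih => exact ih.trans (hstep k ih)
  have h1 := hone k
  have h2 := hstep k h1
  exact ⟨div_nonneg (by linarith) (by linarith), (div_le_one (by linarith)).2 (by linarith)⟩

/-- A nonnegative sequence dominated by the decrements of a sequence bounded below tends to `0`. -/
theorem tendsto_zero_of_le_decrement {e a : ℕ → ℝ} {m : ℝ} (hm : ∀ k, m ≤ e k)
    (ha : ∀ k, 0 ≤ a k) (h : ∀ k, e (k + 1) + a k ≤ e k) :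
    Filter.Tendsto a Filter.atTop (nhds 0) := by
  have hanti : Antitone e := antitone_nat_of_succ_le fun k => by linarith [ha k, h k]
  have hlim := tendsto_atTop_ciInf hanti ⟨m, by rintro _ ⟨k, rfl⟩; exact hm k⟩
  have hdiff := hlim.sub (hlim.comp (Filter.tendsto_add_atTop_nat 1))
  rw [sub_self] at hdiff
  exact squeeze_zero ha (fun k => by simpa using (by linarith [h k] : a k ≤ e k - e (k + 1))) hdiff

/-- Decrease of the objective over one proximal gradient step taken from an extrapolated point. -/
theorem proximal_gradient_decrease {E : Type*} [NormedAddCommGroup E] [InnerProductSpace ℝ E]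
    [CompleteSpace E] {D : E → ℝ} {gradD : E → E}
    (hdiff : ∀ x, HasGradientAt D (gradD x) x) {L : ℝ}
    (hLip : ∀ x y, ‖gradD x - gradD y‖ ≤ L * ‖x - y‖) {γ : ℝ} (hγ : 0 < γ) {s p z : E} {r q : ℝ}
    (hvar : γ * r ≤ γ * q + ⟪s - γ • gradD s - p, p - z⟫) :
    2 * γ * (D p + r) + ‖p - z‖ ^ 2 + (1 - γ * L) * ‖p - s‖ ^ 2
      ≤ 2 * γ * (D z + q) + (1 + γ * L) * ‖z - s‖ ^ 2 := by
  have hup := le_add_inner_add_of_lipschitz_gradient hdiff hLip s p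
  have hlow := add_inner_sub_le_of_lipschitz_gradient hdiff hLip s z
  have hpz : ⟪gradD s, p - s⟫ - ⟪gradD s, z - s⟫ = ⟪gradD s, p - z⟫ := by
    rw [← inner_sub_right, sub_sub_sub_cancel_right]
  have hsplit : ⟪s - γ • gradD s - p, p - z⟫ = ⟪s - p, p - z⟫ - γ * ⟪gradD s, p - z⟫ := by
    rw [sub_right_comm, inner_sub_left, real_inner_smul_left]
  have hthree : ‖z - s‖ ^ 2 = ‖p - s‖ ^ 2 + 2 * ⟪s - p, p - z⟫ + ‖p - z‖ ^ 2 := by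
    have h : s - z = (s - p) + (p - z) := by abel
    rw [norm_sub_rev z s, h, norm_add_sq_real, norm_sub_rev s p]
  have hD : D p - D z - ⟪gradD s, p - z⟫ - L / 2 * ‖p - s‖ ^ 2 - L / 2 * ‖z - s‖ ^ 2 ≤ 0 := by
    linarith
  have hD' := mul_le_mul_of_nonneg_left hD hγ.le
  rw [hsplit] at hvar
  linear_combination 2 * hD' + 2 * hvar - hthree

/-- Proximal maps of convex functions are nonexpansive, in terms of their variational
inequalities. -/
theorem norm_sub_le_of_variational_inequalities {E : Type*} [NormedAddCommGroup E]
    [InnerProductSpace ℝ E] {γ r q : ℝ} {x y p z : E}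
    (hp : γ * r ≤ γ * q + ⟪x - p, p - z⟫) (hz : γ * q ≤ γ * r + ⟪y - z, z - p⟫) :
    ‖p - z‖ ≤ ‖x - y‖ := by
  have h1 : ⟪x - p, p - z⟫ + ⟪y - z, z - p⟫ = ⟪x - y, p - z⟫ - ‖p - z‖ ^ 2 := by
    rw [← neg_sub p z, inner_neg_right, ← sub_eq_add_neg, ← inner_sub_left,
      ← real_inner_self_eq_norm_sq, ← inner_sub_left]
    congr 1
    abel
  have h2 := real_inner_le_norm (x - y) (p - z)
  rcases (norm_nonneg (p - z)).eq_or_lt with h0 | h0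
  · rw [← h0]
    exact norm_nonneg _
  · exact le_of_mul_le_mul_right (by nlinarith) h0

/-- Proposition 3, part (i): convergence of relaxed FISTA to stationary points.
With step size `0 < γ ≤ (1 - α²)/(2L)` and `F* = inf F > -∞`, the gradient-mapping
norms at the iterates converge to zero: `‖G_γ(f_k)‖ → 0`. -/
theorem stmt18 (N : ℕ)
    (D : EuclideanSpace ℝ (Fin N) → ℝ)
    (gradD : EuclideanSpace ℝ (Fin N) → EuclideanSpace ℝ (Fin N))
    (hdiff : ∀ x, HasGradientAt D (gradD x) x)
    (L : ℝ) (hL : 0 < L) (hLip : ∀ x y, ‖gradD x - gradD y‖ ≤ L * ‖x - y‖)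
    (R : EuclideanSpace ℝ (Fin N) → EReal)
    (hRproper : ∃ x, R x ≠ ⊤) (hRbot : ∀ x, R x ≠ ⊥)
    (hRconvex : ∀ x y : EuclideanSpace ℝ (Fin N), ∀ a b : ℝ, 0 ≤ a → 0 ≤ b → a + b = 1 →
      R (a • x + b • y) ≤ (a : EReal) * R x + (b : EReal) * R y)
    (hRlsc : LowerSemicontinuous R)
    (F : EuclideanSpace ℝ (Fin N) → EReal) (hF : ∀ x, F x = (D x : EReal) + R x)
    (γ α : ℝ) (hγ0 : 0 < γ) (hγ : γ ≤ (1 - α ^ 2) / (2 * L)) (hα0 : 0 ≤ α) (hα1 : α < 1)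
    (prox : EuclideanSpace ℝ (Fin N) → EuclideanSpace ℝ (Fin N))
    -- `prox x` is the unique minimizer of `z ↦ R(z) + (1/(2γ))‖z - x‖²`
    (hprox : ∀ x p, p = prox x ↔
      ∀ z, R p + ((1 / (2 * γ) * ‖p - x‖ ^ 2 : ℝ) : EReal) ≤
        R z + ((1 / (2 * γ) * ‖z - x‖ ^ 2 : ℝ) : EReal))
    (t : ℕ → ℝ) (ht0 : t 0 = 1)
    (htrec : ∀ k, t (k + 1) = (Real.sqrt (4 * t k ^ 2 + 1) + 1) / 2)
    (f s : ℕ → EuclideanSpace ℝ (Fin N))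
    (hF0 : F (f 0) ≠ ⊤)
    (hs1 : s 1 = f 0)
    (hfk : ∀ k, 1 ≤ k → f k = prox (s k - γ • gradD (s k)))
    (hsk : ∀ k, 1 ≤ k → s (k + 1) = f k + (α * ((t k - 1) / t (k + 1))) • (f k - f (k - 1)))
    (Fstar : EReal) (hFstar : Fstar = ⨅ x, F x) (hFstarBot : ⊥ < Fstar) :
    Filter.Tendsto (fun k => ‖gradMap γ gradD prox (f k)‖) Filter.atTop (nhds 0) := by
  have hmin : ∀ x z, R (prox x) + ((1 / (2 * γ) * ‖prox x - x‖ ^ 2 : ℝ) : EReal) ≤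
      R z + ((1 / (2 * γ) * ‖z - x‖ ^ 2 : ℝ) : EReal) := fun x => (hprox x _).1 rfl
  have hproxtop : ∀ x, R (prox x) ≠ ⊤ := fun x => ne_top_of_prox_minimizer hRproper (hmin x)
  have hvar : ∀ x z, R z ≠ ⊤ →
      γ * (R (prox x)).toReal ≤ γ * (R z).toReal + ⟪x - prox x, prox x - z⟫ := fun x z hz =>
    prox_variational_inequality hRbot hRconvex hγ0 (hmin x) (hproxtop x) hz
  have hnonexp : ∀ x y, ‖prox x - prox y‖ ≤ ‖x - y‖ := fun x y =>
    norm_sub_le_of_variational_inequalities (hvar x _ (hproxtop y)) (hvar y _ (hproxtop x))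
  have hf : ∀ k, f (k + 1) = prox (s (k + 1) - γ • gradD (s (k + 1))) := fun k =>
    hfk (k + 1) (Nat.le_add_left 1 k)
  have hftop : ∀ k, R (f k) ≠ ⊤ := by
    rintro (_ | k)
    · intro h
      exact hF0 (by rw [hF, h, EReal.coe_add_top])
    · rw [hf]
      exact hproxtop _
  have hFval : ∀ k, F (f k) = ((D (f k) + (R (f k)).toReal : ℝ) : EReal) := fun k => by
    rw [hF, EReal.coe_add, EReal.coe_toReal (hftop k) (hRbot _)]
  have hFle : ∀ k, Fstar ≤ F (f k) := fun k => hFstar ▸ iInf_le F (f k)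
  have hFbdd : ∀ k, Fstar.toReal ≤ D (f k) + (R (f k)).toReal := fun k => by
    have htop : Fstar ≠ ⊤ := ne_top_of_le_ne_top hF0 (hFle 0)
    rw [← EReal.coe_le_coe_iff, ← hFval, EReal.coe_toReal htop hFstarBot.ne']
    exact hFle k
  have hγL : γ * L ≤ (1 - α ^ 2) / 2 := by
    rw [le_div_iff₀ (by positivity)] at hγ
    linarith
  have hα2 : α ^ 2 ≤ 1 := pow_le_one₀ hα0 hα1.le
  have hmom : ∀ k, ‖f k - s (k + 1)‖ ≤ α * ‖f k - f (k - 1)‖ := by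
    rintro (_ | k)
    · simp [hs1]
    · obtain ⟨hw0, hw1⟩ := fista_weight_mem_Icc ht0 htrec (k + 1)
      rw [hsk (k + 1) (Nat.le_add_left 1 k), sub_add_cancel_left, norm_neg, norm_smul,
        Real.norm_of_nonneg (mul_nonneg hα0 hw0)]
      gcongr
      exact mul_le_of_le_one_right hα0 hw1
  have hstep : Filter.Tendsto (fun k => (1 - γ * L) * ‖f (k + 1) - s (k + 1)‖ ^ 2)
      Filter.atTop (nhds 0) := by
    refine tendsto_zero_of_le_decrement (m := 2 * γ * Fstar.toReal)
      (e := fun k => 2 * γ * (D (f k) + (R (f k)).toReal) + ‖f k - f (k - 1)‖ ^ 2) ?_ ?_ ?_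
    · intro k
      have := mul_le_mul_of_nonneg_left (hFbdd k) (by positivity : 0 ≤ 2 * γ)
      linarith [sq_nonneg ‖f k - f (k - 1)‖]
    · intro k
      exact mul_nonneg (by linarith [sq_nonneg α]) (sq_nonneg _)
    · intro k
      have hv := hvar (s (k + 1) - γ • gradD (s (k + 1))) (f k) (hftop k)
      rw [← hf] at hv
      have hdec := proximal_gradient_decrease hdiff hLip hγ0 hv
      have hsq : ‖f k - s (k + 1)‖ ^ 2 ≤ α ^ 2 * ‖f k - f (k - 1)‖ ^ 2 := by
        rw [← mul_pow]
        exact pow_le_pow_left₀ (norm_nonneg _) (hmom k) 2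
      have hcoef : (1 + γ * L) * α ^ 2 ≤ 1 := by
        nlinarith [mul_le_mul_of_nonneg_right hγL (sq_nonneg α), sq_nonneg α]
      have hmul := mul_le_mul_of_nonneg_left hsq (by positivity : 0 ≤ 1 + γ * L)
      have hmul' := mul_le_mul_of_nonneg_right hcoef (sq_nonneg ‖f k - f (k - 1)‖)
      simp only [Nat.add_sub_cancel]
      linarith
  have hdist : Filter.Tendsto (fun k => ‖f (k + 1) - s (k + 1)‖) Filter.atTop (nhds 0) := by
    have hc : 1 - γ * L ≠ 0 := by nlinarith [sq_nonneg α]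
    have h := (hstep.const_mul (1 - γ * L)⁻¹).sqrt
    simpa [inv_mul_cancel_left₀ hc, Real.sqrt_sq] using h
  rw [← Filter.tendsto_add_atTop_iff_nat 1]
  refine squeeze_zero (fun _ => norm_nonneg _) (fun k => ?_)
    (by simpa using hdist.const_mul (γ⁻¹ * (1 + γ * L)))
  rw [gradMap, norm_smul, Real.norm_of_nonneg (inv_nonneg.2 hγ0.le), mul_assoc]
  refine mul_le_mul_of_nonneg_left ?_ (inv_nonneg.2 hγ0.le)
  set u := s (k + 1)
  set v := f (k + 1)
  calc ‖v - prox (v - γ • gradD v)‖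
      = ‖prox (u - γ • gradD u) - prox (v - γ • gradD v)‖ := by rw [← hf k]
    _ ≤ ‖(u - γ • gradD u) - (v - γ • gradD v)‖ := hnonexp _ _
    _ = ‖γ • (gradD v - gradD u) - (v - u)‖ := by congr 1; module
    _ ≤ ‖γ • (gradD v - gradD u)‖ + ‖v - u‖ := norm_sub_le _ _
    _ ≤ γ * (L * ‖v - u‖) + ‖v - u‖ := by
      rw [norm_smul, Real.norm_of_nonneg hγ0.le]
      gcongr
      exact hLip v u
    _ = (1 + γ * L) * ‖v - u‖ := by ring
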